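/- arXiv:1407.1343 — 4 statements merged into one kernel-verified Lean document; each statement's English description precedes it below -/
import Mathlib

section
/- Fix S > 0, K > 0, r ≥ 0, σ > 0, 0 < T₁ < T₂, and assume sup_{u∈ℝ} Re Ψ_J(−(u+iv)) < ∞. For τ ∈ (T₁,T₂) set x_τ := ln(K/S) − rτ and Θ(τ) := S·(1/2π) ∫_ℝ e^{(1+iz)x_τ} · e^{τΨ(−z)} / ( iz(1+iz) ) du, with z = u+iv and Ψ(−z) = iz(1+iz)σ²/2 + Ψ_J(−z). Then Θ is differentiable on (T₁,T₂) and dΘ/dτ = S·(1/2π) ∫_ℝ e^{(1+iz)x_τ} · e^{τΨ(−z)} · ( Ψ(−z) − r(1+iz) ) / ( iz(1+iz) ) du. -/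
open MeasureTheory

/-- Quadratic bound for the first-order Taylor remainder of `exp` on a half-plane. -/
theorem norm_exp_sub_one_sub_id_le_of_re_le {a : ℂ} {v : ℝ} (ha : a.re ≤ v) :
    ‖Complex.exp a - 1 - a‖ ≤ (Real.exp v + 2) * ‖a‖ ^ 2 := by
  have hv := Real.exp_pos v
  rcases le_total ‖a‖ 1 with h | h
  · have := Complex.norm_exp_sub_one_sub_id_le h
    nlinarith [sq_nonneg ‖a‖]
  · have h1 : ‖Complex.exp a - 1 - a‖ ≤ ‖Complex.exp a‖ + 1 + ‖a‖ := by
      have h2 := norm_sub_le (Complex.exp a - 1) a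
      have h3 := norm_sub_le (Complex.exp a) 1
      rw [norm_one] at h3
      linarith
    have h4 : ‖Complex.exp a‖ ≤ Real.exp v := by
      rw [Complex.norm_exp]
      exact Real.exp_le_exp.2 ha
    have h5 : 1 ≤ ‖a‖ ^ 2 := one_le_pow₀ h
    have h6 : ‖a‖ ≤ ‖a‖ ^ 2 := by nlinarith
    nlinarith

/-- Majorant, up to the factor `‖w‖ ^ 2`, of the integrand of the jump exponent. -/
noncomputable def jumpMajorant (v : ℝ) : ℝ → ℝ :=
  {y : ℝ | |y| ≤ 1}.indicator (fun y => (Real.exp v + 3) * y ^ 2) +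
    {y : ℝ | 1 < |y|}.indicator (fun y => Real.exp (v * y) + Real.exp y + 2)

theorem integrable_jumpMajorant {v : ℝ} {ν : Measure ℝ}
    (hν1 : IntegrableOn (fun y : ℝ => y ^ 2) {y : ℝ | |y| ≤ 1} ν)
    (hν2 : ν {y : ℝ | 1 < |y|} < ⊤)
    (hν3 : IntegrableOn (fun y : ℝ => Real.exp (v * y)) {y : ℝ | 1 < |y|} ν)
    (hν4 : IntegrableOn (fun y : ℝ => Real.exp y) {y : ℝ | 1 < |y|} ν) :
    Integrable (jumpMajorant v) ν := by
  refine Integrable.add ?_ ?_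
  · exact IntegrableOn.integrable_indicator (hν1.const_mul _)
      (measurableSet_le measurable_id.abs measurable_const)
  · exact IntegrableOn.integrable_indicator
      ((hν3.add hν4).add (integrableOn_const hν2.ne))
      (measurableSet_lt measurable_const measurable_id.abs)

theorem norm_jump_integrand_le {w : ℂ} {v : ℝ} (hv : 0 ≤ v) (hre : w.re = -v)
    (hw : 1 ≤ ‖w‖) (y : ℝ) :
    ‖Complex.exp (-(w * y)) - 1 + w * (Complex.exp y - 1)‖ ≤ ‖w‖ ^ 2 * jumpMajorant v y := by
  have hw2 : ‖w‖ ≤ ‖w‖ ^ 2 := by nlinarith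
  have hw1 : 1 ≤ ‖w‖ ^ 2 := by linarith
  have hre' : (-(w * y)).re = v * y := by simp [hre]
  rcases le_or_gt |y| 1 with hy | hy
  · have hmaj : jumpMajorant v y = (Real.exp v + 3) * y ^ 2 := by
      simp [jumpMajorant, hy]
    have hsmall : ‖(y : ℂ)‖ ≤ 1 := by simpa using hy
    have h1 : ‖Complex.exp (-(w * y)) - 1 - -(w * y)‖ ≤
        (Real.exp v + 2) * (‖w‖ ^ 2 * y ^ 2) := by
      have := norm_exp_sub_one_sub_id_le_of_re_le (a := -(w * y)) (v := v)
        (by rw [hre']; nlinarith [(abs_le.1 hy).2])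
      simpa [mul_pow] using this
    have h2 : ‖Complex.exp y - 1 - y‖ ≤ y ^ 2 := by
      simpa using Complex.norm_exp_sub_one_sub_id_le hsmall
    have h3 : Complex.exp (-(w * y)) - 1 + w * (Complex.exp y - 1) =
        (Complex.exp (-(w * y)) - 1 - -(w * y)) + w * (Complex.exp y - 1 - y) := by ring
    rw [hmaj, h3]
    refine (norm_add_le _ _).trans ?_
    rw [norm_mul]
    have h4 : ‖w‖ * ‖Complex.exp y - 1 - y‖ ≤ ‖w‖ ^ 2 * y ^ 2 := by gcongr
    linarith
  · have hmaj : jumpMajorant v y = Real.exp (v * y) + Real.exp y + 2 := by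
      simp [jumpMajorant, hy]
    have h1 : ‖Complex.exp (-(w * y)) - 1‖ ≤ Real.exp (v * y) + 1 := by
      refine (norm_sub_le _ _).trans ?_
      rw [Complex.norm_exp, hre', norm_one]
    have h2 : ‖Complex.exp y - 1‖ ≤ Real.exp y + 1 := by
      refine (norm_sub_le _ _).trans ?_
      rw [Complex.norm_exp, Complex.ofReal_re, norm_one]
    rw [hmaj]
    refine (norm_add_le _ _).trans ?_
    rw [norm_mul]
    have h3 : ‖w‖ * ‖Complex.exp y - 1‖ ≤ ‖w‖ ^ 2 * (Real.exp y + 1) := by gcongr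
    have h4 : Real.exp (v * y) + 1 ≤ ‖w‖ ^ 2 * (Real.exp (v * y) + 1) :=
      le_mul_of_one_le_left (by positivity) hw1
    linarith

/-- Differentiation under the integral sign for an exponential family with Gaussian decay. -/
theorem hasDerivAt_integral_exp_mul_exp_div {a p D : ℝ → ℂ}
    (ha : Measurable a) (hp : Measurable p) (hD : Measurable D)
    {L r T₁ T₂ A c δ M : ℝ} (hc : 0 < c)
    (hexp : ∀ t ∈ Set.Ioo T₁ T₂, ∀ u,
      (a u).re * (L - r * t) + t * (p u).re ≤ A - c * u ^ 2)
    (hδ : ∀ u, ‖(D u)⁻¹‖ ≤ δ) (hM : ∀ u, ‖(p u - r * a u) / D u‖ ≤ M)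
    {τ : ℝ} (hτ : τ ∈ Set.Ioo T₁ T₂) :
    HasDerivAt
      (fun t : ℝ => ∫ u : ℝ,
        Complex.exp (a u * ((L - r * t : ℝ) : ℂ)) * Complex.exp ((t : ℂ) * p u) / D u)
      (∫ u : ℝ, Complex.exp (a u * ((L - r * τ : ℝ) : ℂ)) * Complex.exp ((τ : ℂ) * p u) *
        (p u - r * a u) / D u) τ := by
  have hnorm : ∀ t ∈ Set.Ioo T₁ T₂, ∀ u,
      ‖Complex.exp (a u * ((L - r * t : ℝ) : ℂ)) * Complex.exp ((t : ℂ) * p u)‖ ≤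
        Real.exp A * Real.exp (-c * u ^ 2) := by
    intro t ht u
    rw [← Complex.exp_add, Complex.norm_exp, ← Real.exp_add, Complex.add_re,
      Complex.re_mul_ofReal, Complex.re_ofReal_mul]
    exact Real.exp_le_exp.2 (by linarith [hexp t ht u])
  have hgauss : Integrable fun u : ℝ => Real.exp (-c * u ^ 2) := integrable_exp_neg_mul_sq hc
  have hmeas : ∀ t : ℝ, Measurable fun u =>
      Complex.exp (a u * ((L - r * t : ℝ) : ℂ)) * Complex.exp ((t : ℂ) * p u) / D u := by
    intro t
    fun_prop
  refine (hasDerivAt_integral_of_dominated_loc_of_deriv_le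
    (bound := fun u => Real.exp A * Real.exp (-c * u ^ 2) * M)
    (F' := fun t u => Complex.exp (a u * ((L - r * t : ℝ) : ℂ)) *
      Complex.exp ((t : ℂ) * p u) * (p u - r * a u) / D u)
    (Ioo_mem_nhds hτ.1 hτ.2) (.of_forall fun t => (hmeas t).aestronglyMeasurable)
    ?_ ?_ ?_ ((hgauss.const_mul _).mul_const _) ?_).2
  · refine ((hgauss.const_mul (Real.exp A)).mul_const δ).mono'
      (hmeas τ).aestronglyMeasurable (.of_forall fun u => ?_)
    rw [div_eq_mul_inv, norm_mul]
    exact mul_le_mul (hnorm τ hτ u) (hδ u) (norm_nonneg _) (by positivity)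
  · exact Measurable.aestronglyMeasurable (by fun_prop)
  · refine .of_forall fun u t ht => ?_
    rw [mul_div_assoc, norm_mul]
    exact mul_le_mul (hnorm t ht u) (hM u) (norm_nonneg _) (by positivity)
  · refine .of_forall fun u t _ => ?_
    have h1 : HasDerivAt (fun t : ℝ => a u * ((L - r * t : ℝ) : ℂ)) (a u * (-r : ℂ)) t := by
      have : HasDerivAt (fun t : ℝ => L - r * t) (-r) t := by
        simpa using ((hasDerivAt_id t).const_mul r).const_sub L
      simpa using this.ofReal_comp.const_mul (a u)
    have h2 : HasDerivAt (fun t : ℝ => (t : ℂ) * p u) (p u) t := by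
      simpa using (hasDerivAt_id t).ofReal_comp.mul_const (p u)
    refine ((h1.cexp.mul h2.cexp).div_const (D u)).congr_deriv ?_
    ring

/-- Theta of a call option in the Lewis representation: with `x_τ = ln(K/S) - rτ`,
`Ψ(-z) = iz(1+iz)σ²/2 + Ψ_J(-z)` and
`Θ(τ) = S·(1/2π) ∫ e^{(1+iz)x_τ} e^{τΨ(-z)} / (iz(1+iz)) du`, the function `Θ` is
differentiable on `(T₁,T₂)` with
`dΘ/dτ = S·(1/2π) ∫ e^{(1+iz)x_τ} e^{τΨ(-z)} (Ψ(-z) - r(1+iz)) / (iz(1+iz)) du`. -/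
theorem call_Theta
    (v : ℝ) (hv : 1 < v)
    (ν : Measure ℝ) [SigmaFinite ν]
    (hν0 : ν {0} = 0)
    (hν1 : IntegrableOn (fun y : ℝ => y ^ 2) {y : ℝ | |y| ≤ 1} ν)
    (hν2 : ν {y : ℝ | 1 < |y|} < ⊤)
    (hν3 : IntegrableOn (fun y : ℝ => Real.exp (v * y)) {y : ℝ | 1 < |y|} ν)
    (hν4 : IntegrableOn (fun y : ℝ => Real.exp y) {y : ℝ | 1 < |y|} ν)
    (ΨJ : ℝ → ℂ)
    (hΨJ : ∀ u : ℝ, ΨJ u =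
      ∫ y : ℝ,
        (Complex.exp (-(Complex.I * ((u : ℂ) + (v : ℂ) * Complex.I) * (y : ℂ))) - 1 +
          Complex.I * ((u : ℂ) + (v : ℂ) * Complex.I) * (Complex.exp (y : ℂ) - 1)) ∂ν)
    (hsup : ∃ B : ℝ, ∀ u : ℝ, (ΨJ u).re ≤ B)
    (S K r σ T₁ T₂ : ℝ) (hS : 0 < S) (hK : 0 < K) (hr : 0 ≤ r) (hσ : 0 < σ)
    (hT₁ : 0 < T₁) (hT : T₁ < T₂) :
    ∀ τ ∈ Set.Ioo T₁ T₂,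
      HasDerivAt
        (fun t : ℝ => (S : ℂ) * (1 / (2 * (Real.pi : ℂ))) *
          ∫ u : ℝ,
            Complex.exp ((1 + Complex.I * ((u : ℂ) + (v : ℂ) * Complex.I)) *
                ((Real.log (K / S) - r * t : ℝ) : ℂ)) *
              Complex.exp ((t : ℂ) *
                (Complex.I * ((u : ℂ) + (v : ℂ) * Complex.I) *
                    (1 + Complex.I * ((u : ℂ) + (v : ℂ) * Complex.I)) * (σ : ℂ) ^ 2 / 2 +
                  ΨJ u)) /
              (Complex.I * ((u : ℂ) + (v : ℂ) * Complex.I) *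
                (1 + Complex.I * ((u : ℂ) + (v : ℂ) * Complex.I))))
        ((S : ℂ) * (1 / (2 * (Real.pi : ℂ))) *
          ∫ u : ℝ,
            Complex.exp ((1 + Complex.I * ((u : ℂ) + (v : ℂ) * Complex.I)) *
                ((Real.log (K / S) - r * τ : ℝ) : ℂ)) *
              Complex.exp ((τ : ℂ) *
                (Complex.I * ((u : ℂ) + (v : ℂ) * Complex.I) *
                    (1 + Complex.I * ((u : ℂ) + (v : ℂ) * Complex.I)) * (σ : ℂ) ^ 2 / 2 +
                  ΨJ u)) *
              ((Complex.I * ((u : ℂ) + (v : ℂ) * Complex.I) *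
                    (1 + Complex.I * ((u : ℂ) + (v : ℂ) * Complex.I)) * (σ : ℂ) ^ 2 / 2 +
                  ΨJ u) -
                (r : ℂ) * (1 + Complex.I * ((u : ℂ) + (v : ℂ) * Complex.I))) /
              (Complex.I * ((u : ℂ) + (v : ℂ) * Complex.I) *
                (1 + Complex.I * ((u : ℂ) + (v : ℂ) * Complex.I)))) τ := by
  intro τ hτ
  obtain ⟨B, hB⟩ := hsup
  set w : ℝ → ℂ := fun u => Complex.I * ((u : ℂ) + (v : ℂ) * Complex.I) with hw_def
  have hre : ∀ u, (w u).re = -v := fun u => by simp [hw_def]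
  have him : ∀ u, (w u).im = u := fun u => by simp [hw_def]
  have hv_le : ∀ u, v ≤ ‖w u‖ := fun u => by
    have := Complex.abs_re_le_norm (w u)
    rwa [hre, abs_neg, abs_of_pos (by linarith)] at this
  have hw1 : ∀ u, 1 ≤ ‖w u‖ := fun u => hv.le.trans (hv_le u)
  have hv1_le : ∀ u, v - 1 ≤ ‖1 + w u‖ := fun u => by
    have := Complex.abs_re_le_norm (1 + w u)
    rw [Complex.add_re, hre, Complex.one_re] at this
    linarith [neg_le_abs (1 + -v)]
  have hv1 : 0 < v - 1 := by linarith
  have hw_meas : Measurable w := by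
    simp only [hw_def]
    fun_prop
  have hΨ_meas : Measurable ΨJ := by
    have hΨ : ΨJ = fun u => ∫ y : ℝ,
        (Complex.exp (-(w u * (y : ℂ))) - 1 + w u * (Complex.exp (y : ℂ) - 1)) ∂ν := funext hΨJ
    rw [hΨ]
    refine (StronglyMeasurable.integral_prod_right (f := fun u y : ℝ =>
      Complex.exp (-(w u * (y : ℂ))) - 1 + w u * (Complex.exp (y : ℂ) - 1)) ?_).measurable
    exact Measurable.stronglyMeasurable (by fun_prop)
  set C : ℝ := ∫ y, jumpMajorant v y ∂ν with hC_def
  have hΨ_le : ∀ u, ‖ΨJ u‖ ≤ ‖w u‖ ^ 2 * C := fun u => by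
    rw [hΨJ u, hC_def, ← integral_const_mul]
    exact norm_integral_le_of_norm_le
      ((integrable_jumpMajorant hν1 hν2 hν3 hν4).const_mul _)
      (.of_forall fun y => norm_jump_integrand_le (by linarith) (hre u) (hw1 u) y)
  have hC : 0 ≤ C := by
    have := (norm_nonneg _).trans (hΨ_le 0)
    exact nonneg_of_mul_nonneg_right this (by have := hw1 0; positivity)
  refine HasDerivAt.const_mul _ (hasDerivAt_integral_exp_mul_exp_div
    (a := fun u => 1 + w u) (D := fun u => w u * (1 + w u))
    (p := fun u => w u * (1 + w u) * (σ : ℂ) ^ 2 / 2 + ΨJ u)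
    (L := Real.log (K / S)) (r := r) (T₁ := T₁) (T₂ := T₂)
    (A := (v - 1) * (|Real.log (K / S)| + r * T₂) + T₂ * ((v ^ 2 - v) * σ ^ 2 / 2 + |B|))
    (c := T₁ * σ ^ 2 / 2) (δ := (v * (v - 1))⁻¹)
    (M := σ ^ 2 / 2 + C * (v / (v - 1)) + r)
    (by fun_prop) (by fun_prop) (by fun_prop) (by positivity) ?_ ?_ ?_ hτ)
  · rintro t ⟨ht1, ht2⟩ u
    have hp : (w u * (1 + w u) * (σ : ℂ) ^ 2 / 2 + ΨJ u).re =
        (v ^ 2 - v - u ^ 2) * σ ^ 2 / 2 + (ΨJ u).re := by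
      have : w u * (1 + w u) * (σ : ℂ) ^ 2 / 2 = w u * (1 + w u) * ((σ ^ 2 / 2 : ℝ) : ℂ) := by
        push_cast
        ring
      rw [Complex.add_re, this, Complex.re_mul_ofReal]
      simp only [Complex.mul_re, Complex.add_re, Complex.add_im, Complex.one_re, Complex.one_im,
        hre, him]
      ring
    simp only [hp, Complex.add_re, Complex.one_re, hre]
    have h1 : (1 + -v) * (Real.log (K / S) - r * t) ≤
        (v - 1) * (|Real.log (K / S)| + r * T₂) := by
      have : -(Real.log (K / S) - r * t) ≤ |Real.log (K / S)| + r * T₂ := by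
        nlinarith [neg_le_abs (Real.log (K / S))]
      nlinarith
    have h2 : t * (ΨJ u).re ≤ T₂ * |B| := by
      have := (hB u).trans (le_abs_self B)
      nlinarith [abs_nonneg B]
    have h3 : t * ((v ^ 2 - v) * σ ^ 2 / 2) ≤ T₂ * ((v ^ 2 - v) * σ ^ 2 / 2) := by
      have : 0 ≤ v ^ 2 - v := by nlinarith
      gcongr
    have h4 : T₁ * (u ^ 2 * σ ^ 2 / 2) ≤ t * (u ^ 2 * σ ^ 2 / 2) := by gcongr
    linarith
  · intro u
    rw [norm_inv, norm_mul]
    have := hv_le u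
    have := hv1_le u
    gcongr
  · intro u
    have hw_pos : 0 < ‖w u‖ := by linarith [hw1 u]
    have h1w_pos : 0 < ‖1 + w u‖ := hv1.trans_le (hv1_le u)
    have hw0 : w u ≠ 0 := norm_pos_iff.1 hw_pos
    have h1w0 : 1 + w u ≠ 0 := norm_pos_iff.1 h1w_pos
    have hsplit : (w u * (1 + w u) * (σ : ℂ) ^ 2 / 2 + ΨJ u - r * (1 + w u)) /
        (w u * (1 + w u)) = ((σ ^ 2 / 2 : ℝ) : ℂ) + ΨJ u / (w u * (1 + w u)) - r / w u := by
      push_cast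
      field_simp
    have hΨ_div : ‖ΨJ u / (w u * (1 + w u))‖ ≤ C * (v / (v - 1)) := by
      have hratio : ‖w u‖ / ‖1 + w u‖ ≤ v / (v - 1) := by
        have : ‖w u‖ ≤ ‖1 + w u‖ + 1 := by
          have := norm_sub_le (1 + w u) 1
          rwa [add_sub_cancel_left, norm_one] at this
        rw [div_le_div_iff₀ h1w_pos hv1]
        nlinarith [hv1_le u]
      rw [norm_div, norm_mul]
      calc ‖ΨJ u‖ / (‖w u‖ * ‖1 + w u‖) ≤ ‖w u‖ ^ 2 * C / (‖w u‖ * ‖1 + w u‖) := by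
            gcongr
            exact hΨ_le u
        _ = C * (‖w u‖ / ‖1 + w u‖) := by field_simp
        _ ≤ C * (v / (v - 1)) := by gcongr
    have hr_div : ‖(r : ℂ) / w u‖ ≤ r := by
      rw [norm_div, Complex.norm_real, Real.norm_of_nonneg hr]
      exact div_le_self hr (hw1 u)
    have hσ_norm : ‖((σ ^ 2 / 2 : ℝ) : ℂ)‖ = σ ^ 2 / 2 := by
      rw [Complex.norm_real, Real.norm_of_nonneg (by positivity)]
    rw [hsplit]
    refine (norm_sub_le _ _).trans (add_le_add ((norm_add_le _ _).trans ?_) hr_div)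
    rw [hσ_norm]
    linarith
end

section
/- Assume sup_{u∈ℝ} Re Ψ_J(−(u+iv)) < ∞ and fix 0 < Σ₁ < Σ₂ and x ∈ ℝ. For σ ∈ (Σ₁,Σ₂) and z = u+iv define Ψ_σ(−z) := iz(1+iz)σ²/2 + Ψ_J(−z) and the Delta Δ(σ) := −(1/2π) ∫_ℝ e^{(1+iz)x} · e^{τΨ_σ(−z)} / (1+iz) du. Then Δ is differentiable on (Σ₁,Σ₂) and the Vanna satisfies Δ'(σ) = −τσ·(1/2π) ∫_ℝ iz · e^{(1+iz)x} · e^{τΨ_σ(−z)} du (which in the Lévy model equals −τσ·e^{x}·f_τ'(x), f_τ the density of the log-return). -/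
open MeasureTheory

/-- The integral defining the jump exponent depends measurably on its parameter. -/
theorem stronglyMeasurable_jumpExponent (ν : Measure ℝ) [SigmaFinite ν] (v : ℝ) :
    StronglyMeasurable fun u : ℝ => ∫ y : ℝ,
      (Complex.exp (-(Complex.I * ((u : ℂ) + (v : ℂ) * Complex.I) * (y : ℂ))) - 1 +
        Complex.I * ((u : ℂ) + (v : ℂ) * Complex.I) * (Complex.exp (y : ℂ) - 1)) ∂ν := by
  refine StronglyMeasurable.integral_prod_right (f := fun u y : ℝ =>
      (Complex.exp (-(Complex.I * ((u : ℂ) + (v : ℂ) * Complex.I) * (y : ℂ))) - 1 +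
        Complex.I * ((u : ℂ) + (v : ℂ) * Complex.I) * (Complex.exp (y : ℂ) - 1))) ?_
  refine Continuous.stronglyMeasurable ?_
  simp only [Function.uncurry_def]
  fun_prop

/-- Gaussian domination of the discounted Fourier kernel, uniformly for volatilities in
`[s₁, s₂]`. -/
theorem norm_exp_mul_exp_charExponent_le {v τ B s₁ s₂ σ : ℝ} (x u : ℝ) {w : ℂ} (hv : 1 < v)
    (hτ : 0 < τ) (hw : w.re ≤ B) (hs₁ : 0 < s₁) (h₁ : s₁ ≤ σ) (h₂ : σ ≤ s₂) :
    ‖Complex.exp ((1 + Complex.I * ((u : ℂ) + (v : ℂ) * Complex.I)) * (x : ℂ)) *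
        Complex.exp ((τ : ℂ) * (Complex.I * ((u : ℂ) + (v : ℂ) * Complex.I) *
          (1 + Complex.I * ((u : ℂ) + (v : ℂ) * Complex.I)) * (σ : ℂ) ^ 2 / 2 + w))‖ ≤
      Real.exp ((1 - v) * x + τ * ((v ^ 2 - v) * s₂ ^ 2 / 2 + B)) *
        Real.exp (-(τ * s₁ ^ 2 / 2) * u ^ 2) := by
  have hx : ((1 + Complex.I * ((u : ℂ) + (v : ℂ) * Complex.I)) * (x : ℂ)).re = (1 - v) * x := by
    simp [sub_eq_add_neg]
  have hz : Complex.I * ((u : ℂ) + (v : ℂ) * Complex.I) *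
      (1 + Complex.I * ((u : ℂ) + (v : ℂ) * Complex.I)) =
      ((v ^ 2 - v - u ^ 2 : ℝ) : ℂ) + ((u - 2 * u * v : ℝ) : ℂ) * Complex.I := by
    apply Complex.ext <;> simp [pow_two] <;> ring
  have hΨ : ((τ : ℂ) * (Complex.I * ((u : ℂ) + (v : ℂ) * Complex.I) *
      (1 + Complex.I * ((u : ℂ) + (v : ℂ) * Complex.I)) * (σ : ℂ) ^ 2 / 2 + w)).re =
      τ * ((v ^ 2 - v - u ^ 2) * σ ^ 2 / 2 + w.re) := by
    have hσ : (σ : ℂ) ^ 2 / 2 = ((σ ^ 2 / 2 : ℝ) : ℂ) := by push_cast; ring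
    rw [hz, mul_div_assoc, hσ, Complex.re_ofReal_mul, Complex.add_re, Complex.re_mul_ofReal,
      mul_div_assoc]
    simp [pow_two]
  rw [norm_mul, Complex.norm_exp, Complex.norm_exp, hx, hΨ, ← Real.exp_add, ← Real.exp_add,
    Real.exp_le_exp]
  have hσ₂ : σ ^ 2 ≤ s₂ ^ 2 := by gcongr; linarith
  have hσ₁ : s₁ ^ 2 ≤ σ ^ 2 := by gcongr
  have hvv : 0 ≤ v ^ 2 - v := by nlinarith
  have key : (v ^ 2 - v - u ^ 2) * σ ^ 2 / 2 + w.re ≤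
      (v ^ 2 - v) * s₂ ^ 2 / 2 + B - s₁ ^ 2 / 2 * u ^ 2 := by
    nlinarith [mul_le_mul_of_nonneg_left hσ₂ hvv, mul_le_mul_of_nonneg_left hσ₁ (sq_nonneg u)]
  linarith [mul_le_mul_of_nonneg_left key hτ.le]

/-- Vanna of a call option in the Lewis representation: with
`Ψ_σ(-z) = iz(1+iz)σ²/2 + Ψ_J(-z)` and the Delta
`Δ(σ) = -(1/2π) ∫ e^{(1+iz)x} e^{τΨ_σ(-z)} / (1+iz) du`, the function `Δ` is
differentiable on `(Sig₁,Sig₂)` with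
`Δ'(σ) = -τσ·(1/2π) ∫ iz e^{(1+iz)x} e^{τΨ_σ(-z)} du`. -/
theorem call_Vanna
    (v τ : ℝ) (hv : 1 < v) (hτ : 0 < τ)
    (ν : Measure ℝ) [SigmaFinite ν]
    (hν0 : ν {0} = 0)
    (hν1 : IntegrableOn (fun y : ℝ => y ^ 2) {y : ℝ | |y| ≤ 1} ν)
    (hν2 : ν {y : ℝ | 1 < |y|} < ⊤)
    (hν3 : IntegrableOn (fun y : ℝ => Real.exp (v * y)) {y : ℝ | 1 < |y|} ν)
    (hν4 : IntegrableOn (fun y : ℝ => Real.exp y) {y : ℝ | 1 < |y|} ν)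
    (ΨJ : ℝ → ℂ)
    (hΨJ : ∀ u : ℝ, ΨJ u =
      ∫ y : ℝ,
        (Complex.exp (-(Complex.I * ((u : ℂ) + (v : ℂ) * Complex.I) * (y : ℂ))) - 1 +
          Complex.I * ((u : ℂ) + (v : ℂ) * Complex.I) * (Complex.exp (y : ℂ) - 1)) ∂ν)
    (hsup : ∃ B : ℝ, ∀ u : ℝ, (ΨJ u).re ≤ B)
    (Sig₁ Sig₂ x : ℝ) (hSig₁ : 0 < Sig₁) (hSig : Sig₁ < Sig₂) :
    ∀ σ ∈ Set.Ioo Sig₁ Sig₂,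
      HasDerivAt
        (fun σ : ℝ => -(1 / (2 * (Real.pi : ℂ))) *
          ∫ u : ℝ,
            Complex.exp ((1 + Complex.I * ((u : ℂ) + (v : ℂ) * Complex.I)) * (x : ℂ)) *
              Complex.exp ((τ : ℂ) *
                (Complex.I * ((u : ℂ) + (v : ℂ) * Complex.I) *
                    (1 + Complex.I * ((u : ℂ) + (v : ℂ) * Complex.I)) * (σ : ℂ) ^ 2 / 2 +
                  ΨJ u)) /
              (1 + Complex.I * ((u : ℂ) + (v : ℂ) * Complex.I)))
        (-((τ : ℂ) * (σ : ℂ)) * (1 / (2 * (Real.pi : ℂ))) *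
          ∫ u : ℝ,
            Complex.I * ((u : ℂ) + (v : ℂ) * Complex.I) *
              Complex.exp ((1 + Complex.I * ((u : ℂ) + (v : ℂ) * Complex.I)) * (x : ℂ)) *
              Complex.exp ((τ : ℂ) *
                (Complex.I * ((u : ℂ) + (v : ℂ) * Complex.I) *
                    (1 + Complex.I * ((u : ℂ) + (v : ℂ) * Complex.I)) * (σ : ℂ) ^ 2 / 2 +
                  ΨJ u))) σ := by
  intro σ hσ
  obtain ⟨B, hB⟩ := hsup
  have hmeas : Measurable ΨJ := by
    rw [funext hΨJ]
    exact (stronglyMeasurable_jumpExponent ν v).measurable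
  have hden : ∀ u : ℝ, (1 + Complex.I * ((u : ℂ) + (v : ℂ) * Complex.I)) ≠ 0 := fun u h => by
    have := congrArg Complex.re h
    simp at this
    linarith
  have hden_norm : ∀ u : ℝ, v - 1 ≤ ‖1 + Complex.I * ((u : ℂ) + (v : ℂ) * Complex.I)‖ :=
    fun u => by
      refine le_trans ?_ (Complex.abs_re_le_norm _)
      refine le_trans ?_ (neg_le_abs _)
      simp
  have hz_norm : ∀ u : ℝ, ‖Complex.I * ((u : ℂ) + (v : ℂ) * Complex.I)‖ ≤ |u| + v := fun u => by
    rw [norm_mul, Complex.norm_I, one_mul]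
    refine (norm_add_le _ _).trans ?_
    simp [abs_of_pos (zero_lt_one.trans hv)]
  set K : ℝ := Real.exp ((1 - v) * x + τ * ((v ^ 2 - v) * Sig₂ ^ 2 / 2 + B))
  set b : ℝ := τ * Sig₁ ^ 2 / 2
  have hb0 : 0 < b := by positivity
  have hkernel := fun (s : ℝ) (hs : s ∈ Set.Ioo Sig₁ Sig₂) (u : ℝ) =>
    norm_exp_mul_exp_charExponent_le x u hv hτ (hB u) hSig₁ hs.1.le hs.2.le
  have hgauss : Integrable fun u : ℝ => Real.exp (-b * u ^ 2) := integrable_exp_neg_mul_sq hb0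
  have hgauss_abs : Integrable fun u : ℝ => |u| * Real.exp (-b * u ^ 2) := by
    simpa [abs_mul] using (integrable_mul_exp_neg_mul_sq hb0).norm
  have hderiv := (hasDerivAt_integral_of_dominated_loc_of_deriv_le (μ := volume) (x₀ := σ)
    (F := fun (σ u : ℝ) =>
      Complex.exp ((1 + Complex.I * ((u : ℂ) + (v : ℂ) * Complex.I)) * (x : ℂ)) *
        Complex.exp ((τ : ℂ) *
          (Complex.I * ((u : ℂ) + (v : ℂ) * Complex.I) *
              (1 + Complex.I * ((u : ℂ) + (v : ℂ) * Complex.I)) * (σ : ℂ) ^ 2 / 2 + ΨJ u)) /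
        (1 + Complex.I * ((u : ℂ) + (v : ℂ) * Complex.I)))
    (F' := fun (σ u : ℝ) => ((τ : ℂ) * (σ : ℂ)) *
      (Complex.I * ((u : ℂ) + (v : ℂ) * Complex.I) *
        Complex.exp ((1 + Complex.I * ((u : ℂ) + (v : ℂ) * Complex.I)) * (x : ℂ)) *
        Complex.exp ((τ : ℂ) *
          (Complex.I * ((u : ℂ) + (v : ℂ) * Complex.I) *
              (1 + Complex.I * ((u : ℂ) + (v : ℂ) * Complex.I)) * (σ : ℂ) ^ 2 / 2 + ΨJ u))))
    (bound := fun u => τ * Sig₂ * ((|u| + v) * (K * Real.exp (-b * u ^ 2))))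
    (Ioo_mem_nhds hσ.1 hσ.2) ?_ ?_ ?_ ?_ ?_ ?_).2
  · rw [integral_const_mul] at hderiv
    exact (hderiv.const_mul (-(1 / (2 * (Real.pi : ℂ))))).congr_deriv (by ring)
  · exact Filter.Eventually.of_forall fun s => by
      apply Measurable.aestronglyMeasurable
      fun_prop
  · refine Integrable.mono' ((hgauss.const_mul K).div_const (v - 1)) ?_
      (Filter.Eventually.of_forall fun u => ?_)
    · apply Measurable.aestronglyMeasurable
      fun_prop
    · rw [norm_div]
      exact div_le_div₀ (by positivity) (hkernel σ hσ u) (by linarith) (hden_norm u)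
  · apply Measurable.aestronglyMeasurable
    fun_prop
  · refine Filter.Eventually.of_forall fun u s hs => ?_
    have hs0 : 0 < s := hSig₁.trans hs.1
    rw [mul_assoc (Complex.I * _), norm_mul, norm_mul (Complex.I * _)]
    have hτs : ‖(τ : ℂ) * (s : ℂ)‖ ≤ τ * Sig₂ := by
      rw [norm_mul, Complex.norm_of_nonneg hτ.le, Complex.norm_of_nonneg hs0.le]
      gcongr
      exact hs.2.le
    have hSig₂ : 0 < Sig₂ := hSig₁.trans hSig
    exact mul_le_mul hτs (mul_le_mul (hz_norm u) (hkernel s hs u) (norm_nonneg _) (by positivity))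
      (by positivity) (by positivity)
  · have hsum := (((hgauss_abs.add (hgauss.const_mul v)).const_mul K).const_mul (τ * Sig₂))
    refine hsum.congr (Filter.Eventually.of_forall fun u => ?_)
    simp only [Pi.add_apply]
    ring
  · refine Filter.Eventually.of_forall fun u s _ => ?_
    have hsq : HasDerivAt (fun s : ℝ => (s : ℂ) ^ 2) (2 * (s : ℂ)) s := by
      simpa using (hasDerivAt_pow 2 s).ofReal_comp
    have hexp := (((((hsq.const_mul (Complex.I * ((u : ℂ) + (v : ℂ) * Complex.I) *
      (1 + Complex.I * ((u : ℂ) + (v : ℂ) * Complex.I)))).div_const 2).add_const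
      (ΨJ u)).const_mul (τ : ℂ)).cexp.const_mul
      (Complex.exp ((1 + Complex.I * ((u : ℂ) + (v : ℂ) * Complex.I)) * (x : ℂ)))).div_const
      (1 + Complex.I * ((u : ℂ) + (v : ℂ) * Complex.I))
    refine hexp.congr_deriv ?_
    rw [div_eq_iff (hden u)]
    ring
end

section
/- Assume sup_{u∈ℝ} Re Ψ_J(−(u+iv)) < ∞ and fix 0 < Σ₁ < Σ₂ and x ∈ ℝ. For σ ∈ (Σ₁,Σ₂) and z = u+iv define Ψ_σ(−z) := iz(1+iz)σ²/2 + Ψ_J(−z) and V(σ) := (e^{x}/2π) ∫_ℝ e^{izx} · e^{τΨ_σ(−z)} / ( iz(1+iz) ) du. Then V is twice differentiable on (Σ₁,Σ₂) and the Vomma satisfies V''(σ) = τ·(e^{x}/2π) ∫_ℝ e^{izx} · e^{τΨ_σ(−z)} · ( 1 + τσ²·iz(1+iz) ) du (which in the Lévy model equals τ·e^{x}·( f_τ(x) + τσ²(f_τ'(x)+f_τ''(x)) ), f_τ the density of the log-return). -/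
open MeasureTheory

/-- If `g` is bounded and the exponent `q` grows at most quadratically with `Re q = A - u²`, then
`s ↦ ∫ g exp(q s)` may be differentiated under the integral sign at every `s > 0`. -/
theorem hasDerivAt_integral_mul_cexp {g q : ℝ → ℂ} {A C K s : ℝ}
    (hg : AEStronglyMeasurable g) (hq : AEStronglyMeasurable q)
    (hgC : ∀ u, ‖g u‖ ≤ C) (hqK : ∀ u, ‖q u‖ ≤ K * (1 + u ^ 2))
    (hqre : ∀ u, (q u).re = A - u ^ 2) (hs : 0 < s) :
    Integrable (fun u => g u * Complex.exp (q u * s)) ∧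
    Integrable (fun u => g u * q u * Complex.exp (q u * s)) ∧
    HasDerivAt (fun s : ℝ => ∫ u, g u * Complex.exp (q u * s))
      (∫ u, g u * q u * Complex.exp (q u * s)) s := by
  have hC : 0 ≤ C := (norm_nonneg _).trans (hgC 0)
  have hK : 0 ≤ K := by simpa using (norm_nonneg _).trans (hqK 0)
  have hexp (u t : ℝ) (ht : t ∈ Set.Ioo (s / 2) (2 * s)) :
      ‖Complex.exp (q u * t)‖ ≤ Real.exp (|A| * (2 * s)) * Real.exp (-(s / 2) * u ^ 2) := by
    rw [Complex.norm_exp, ← Real.exp_add, Real.exp_le_exp, Complex.re_mul_ofReal, hqre]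
    have h₁ : A * t ≤ |A| * (2 * s) :=
      mul_le_mul (le_abs_self A) ht.2.le (by linarith [ht.1]) (abs_nonneg A)
    have h₂ : (s / 2) * u ^ 2 ≤ t * u ^ 2 :=
      mul_le_mul_of_nonneg_right ht.1.le (sq_nonneg u)
    linarith
  have hmem : s ∈ Set.Ioo (s / 2) (2 * s) := ⟨by linarith, by linarith⟩
  have hgauss : Integrable fun u : ℝ => Real.exp (-(s / 2) * u ^ 2) :=
    integrable_exp_neg_mul_sq (by linarith)
  have hgauss₂ : Integrable fun u : ℝ => u ^ 2 * Real.exp (-(s / 2) * u ^ 2) := by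
    simpa using integrable_rpow_mul_exp_neg_mul_sq (b := s / 2) (by linarith) (s := 2) (by norm_num)
  have hmeas (t : ℝ) : AEStronglyMeasurable fun u => Complex.exp (q u * t) :=
    Complex.continuous_exp.comp_aestronglyMeasurable (hq.mul_const _)
  have hint : Integrable (fun u => g u * Complex.exp (q u * s)) := by
    refine (hgauss.const_mul (C * Real.exp (|A| * (2 * s)))).mono' (hg.mul (hmeas s))
      (ae_of_all _ fun u => ?_)
    rw [norm_mul, mul_assoc]
    exact mul_le_mul (hgC u) (hexp u s hmem) (norm_nonneg _) hC
  have hbound : Integrable fun u : ℝ =>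
      C * (K * (1 + u ^ 2)) * (Real.exp (|A| * (2 * s)) * Real.exp (-(s / 2) * u ^ 2)) := by
    refine ((hgauss.add hgauss₂).const_mul (C * K * Real.exp (|A| * (2 * s)))).congr
      (ae_of_all _ fun u => ?_)
    simp only [Pi.add_apply]
    ring
  have key := hasDerivAt_integral_of_dominated_loc_of_deriv_le (μ := volume)
    (F := fun (t : ℝ) u => g u * Complex.exp (q u * t))
    (F' := fun (t : ℝ) u => g u * q u * Complex.exp (q u * t))
    (Ioo_mem_nhds hmem.1 hmem.2) (Filter.Eventually.of_forall fun t => hg.mul (hmeas t)) hint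
    ((hg.mul hq).mul (hmeas s))
    (ae_of_all _ fun u t ht => by
      rw [norm_mul, norm_mul]
      have := hgC u
      have := hqK u
      have := hexp u t ht
      gcongr)
    hbound
    (ae_of_all _ fun u t _ => by
      have h := ((Complex.ofRealCLM.hasDerivAt (x := t)).const_mul (q u)).cexp.const_mul (g u)
      simp only [Complex.ofRealCLM_apply, Complex.ofReal_one, mul_one] at h
      exact h.congr_deriv (by ring))
  exact ⟨hint, key⟩

/-- The symbol `iz(1+iz)` at `z = u + iv`, split into real and imaginary parts. -/
theorem symbol_eq (u v : ℝ) :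
    Complex.I * ((u : ℂ) + (v : ℂ) * Complex.I) *
        (1 + Complex.I * ((u : ℂ) + (v : ℂ) * Complex.I)) =
      (v ^ 2 - v - u ^ 2 : ℝ) + ((1 - 2 * v) * u : ℝ) * Complex.I := by
  apply Complex.ext
  · simp [pow_two]
    ring
  · simp [pow_two]
    ring

theorem norm_symbol_le (u v : ℝ) (hv : 1 < v) :
    ‖Complex.I * ((u : ℂ) + (v : ℂ) * Complex.I) *
        (1 + Complex.I * ((u : ℂ) + (v : ℂ) * Complex.I))‖ ≤ (v ^ 2 + v) * (1 + u ^ 2) := by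
  rw [symbol_eq]
  refine (Complex.norm_le_abs_re_add_abs_im _).trans ?_
  simp only [Complex.add_re, Complex.add_im, Complex.re_ofReal_mul, Complex.im_ofReal_mul,
    Complex.ofReal_re, Complex.ofReal_im, Complex.I_re, Complex.I_im]
  have h₁ : |v ^ 2 - v - u ^ 2 + (1 - 2 * v) * u * 0| ≤ v ^ 2 - v + u ^ 2 :=
    abs_le.2 ⟨by nlinarith, by nlinarith⟩
  have h₂ : |0 + (1 - 2 * v) * u * 1| ≤ v * (1 + u ^ 2) :=
    abs_le.2 ⟨by nlinarith [sq_nonneg (u - 1), sq_nonneg (u + 1)],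
      by nlinarith [sq_nonneg (u - 1), sq_nonneg (u + 1)]⟩
  nlinarith [mul_nonneg (show 0 ≤ v ^ 2 - v by nlinarith) (sq_nonneg u)]

theorem le_norm_symbol (u v : ℝ) (hv : 1 < v) :
    v * (v - 1) ≤ ‖Complex.I * ((u : ℂ) + (v : ℂ) * Complex.I) *
        (1 + Complex.I * ((u : ℂ) + (v : ℂ) * Complex.I))‖ := by
  rw [norm_mul]
  refine mul_le_mul ?_ ?_ (by linarith) (norm_nonneg _)
  · refine le_trans ?_ (Complex.abs_re_le_norm _)
    simp [le_abs_self]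
  · refine le_trans ?_ (Complex.abs_re_le_norm _)
    refine le_trans ?_ (neg_le_abs _)
    simp

/-- Vomma of a call option in the Lewis representation: with
`Ψ_σ(-z) = iz(1+iz)σ²/2 + Ψ_J(-z)` and
`V(σ) = (e^x/2π) ∫ e^{izx} e^{τΨ_σ(-z)} / (iz(1+iz)) du`, the function `V` is twice
differentiable on `(Sig₁,Sig₂)` with
`V''(σ) = τ·(e^x/2π) ∫ e^{izx} e^{τΨ_σ(-z)} (1 + τσ²·iz(1+iz)) du`. -/
theorem call_Vomma
    (v τ : ℝ) (hv : 1 < v) (hτ : 0 < τ)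
    (ν : Measure ℝ) [SigmaFinite ν]
    (hν0 : ν {0} = 0)
    (hν1 : IntegrableOn (fun y : ℝ => y ^ 2) {y : ℝ | |y| ≤ 1} ν)
    (hν2 : ν {y : ℝ | 1 < |y|} < ⊤)
    (hν3 : IntegrableOn (fun y : ℝ => Real.exp (v * y)) {y : ℝ | 1 < |y|} ν)
    (hν4 : IntegrableOn (fun y : ℝ => Real.exp y) {y : ℝ | 1 < |y|} ν)
    (ΨJ : ℝ → ℂ)
    (hΨJ : ∀ u : ℝ, ΨJ u =
      ∫ y : ℝ,
        (Complex.exp (-(Complex.I * ((u : ℂ) + (v : ℂ) * Complex.I) * (y : ℂ))) - 1 +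
          Complex.I * ((u : ℂ) + (v : ℂ) * Complex.I) * (Complex.exp (y : ℂ) - 1)) ∂ν)
    (hsup : ∃ B : ℝ, ∀ u : ℝ, (ΨJ u).re ≤ B)
    (Sig₁ Sig₂ x : ℝ) (hSig₁ : 0 < Sig₁) (hSig : Sig₁ < Sig₂) :
    ∀ σ ∈ Set.Ioo Sig₁ Sig₂,
      DifferentiableAt ℝ
        (fun σ : ℝ => ((Real.exp x : ℂ) / (2 * (Real.pi : ℂ))) *
          ∫ u : ℝ,
            Complex.exp (Complex.I * ((u : ℂ) + (v : ℂ) * Complex.I) * (x : ℂ)) *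
              Complex.exp ((τ : ℂ) *
                (Complex.I * ((u : ℂ) + (v : ℂ) * Complex.I) *
                    (1 + Complex.I * ((u : ℂ) + (v : ℂ) * Complex.I)) * (σ : ℂ) ^ 2 / 2 +
                  ΨJ u)) /
              (Complex.I * ((u : ℂ) + (v : ℂ) * Complex.I) *
                (1 + Complex.I * ((u : ℂ) + (v : ℂ) * Complex.I)))) σ ∧
      HasDerivAt
        (deriv fun σ : ℝ => ((Real.exp x : ℂ) / (2 * (Real.pi : ℂ))) *
          ∫ u : ℝ,
            Complex.exp (Complex.I * ((u : ℂ) + (v : ℂ) * Complex.I) * (x : ℂ)) *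
              Complex.exp ((τ : ℂ) *
                (Complex.I * ((u : ℂ) + (v : ℂ) * Complex.I) *
                    (1 + Complex.I * ((u : ℂ) + (v : ℂ) * Complex.I)) * (σ : ℂ) ^ 2 / 2 +
                  ΨJ u)) /
              (Complex.I * ((u : ℂ) + (v : ℂ) * Complex.I) *
                (1 + Complex.I * ((u : ℂ) + (v : ℂ) * Complex.I))))
        ((τ : ℂ) * ((Real.exp x : ℂ) / (2 * (Real.pi : ℂ))) *
          ∫ u : ℝ,
            Complex.exp (Complex.I * ((u : ℂ) + (v : ℂ) * Complex.I) * (x : ℂ)) *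
              Complex.exp ((τ : ℂ) *
                (Complex.I * ((u : ℂ) + (v : ℂ) * Complex.I) *
                    (1 + Complex.I * ((u : ℂ) + (v : ℂ) * Complex.I)) * (σ : ℂ) ^ 2 / 2 +
                  ΨJ u)) *
              (1 + (τ : ℂ) * (σ : ℂ) ^ 2 * Complex.I * ((u : ℂ) + (v : ℂ) * Complex.I) *
                (1 + Complex.I * ((u : ℂ) + (v : ℂ) * Complex.I)))) σ := by
  obtain ⟨B, hB⟩ := hsup
  set z : ℝ → ℂ := fun u => Complex.I * ((u : ℂ) + (v : ℂ) * Complex.I) with hz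
  have hzc : Continuous z := by fun_prop
  set q : ℝ → ℂ := fun u => z u * (1 + z u) with hqdef
  set w : ℝ → ℂ := fun u => Complex.exp (z u * x) * Complex.exp (τ * ΨJ u) with hw
  have hqc : Continuous q := by fun_prop
  have hqm : AEStronglyMeasurable q := hqc.aestronglyMeasurable
  have hqre (u : ℝ) : (q u).re = (v ^ 2 - v) - u ^ 2 := by
    simp only [hqdef, hz, symbol_eq]
    simp [pow_two]
  have hqle (u : ℝ) : ‖q u‖ ≤ (v ^ 2 + v) * (1 + u ^ 2) := norm_symbol_le u v hv
  have hleq (u : ℝ) : v * (v - 1) ≤ ‖q u‖ := le_norm_symbol u v hv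
  have hv' : 0 < v * (v - 1) := mul_pos (by linarith) (by linarith)
  have hq0 (u : ℝ) : q u ≠ 0 := norm_pos_iff.1 (hv'.trans_le (hleq u))
  have hΨm : StronglyMeasurable ΨJ := by
    rw [show ΨJ = _ from funext hΨJ]
    refine StronglyMeasurable.integral_prod_right (ν := ν) (f := fun (u y : ℝ) =>
      Complex.exp (-(Complex.I * ((u : ℂ) + (v : ℂ) * Complex.I) * (y : ℂ))) - 1 +
        Complex.I * ((u : ℂ) + (v : ℂ) * Complex.I) * (Complex.exp (y : ℂ) - 1)) ?_
    exact Continuous.stronglyMeasurable (by fun_prop)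
  have hwm : StronglyMeasurable w :=
    (Continuous.stronglyMeasurable (by fun_prop)).mul
      (Complex.continuous_exp.comp_stronglyMeasurable (hΨm.const_mul _))
  have hwC (u : ℝ) : ‖w u‖ ≤ Real.exp (-(v * x)) * Real.exp (τ * B) := by
    rw [hw, norm_mul, Complex.norm_exp, Complex.norm_exp, Complex.re_ofReal_mul]
    gcongr
    · simp [hz]
    · exact hB u
  have hgC (u : ℝ) :
      ‖w u / q u‖ ≤ Real.exp (-(v * x)) * Real.exp (τ * B) / (v * (v - 1)) := by
    rw [norm_div]
    exact div_le_div₀ (by positivity) (hwC u) hv' (hleq u)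
  have hgm : StronglyMeasurable fun u => w u / q u :=
    (hwm.measurable.div hqc.measurable).stronglyMeasurable
  set c : ℂ := (Real.exp x : ℂ) / (2 * (Real.pi : ℂ)) with hc
  have hexp (s u : ℝ) :
      Complex.exp (z u * x) * Complex.exp (τ * (q u * (s : ℂ) ^ 2 / 2 + ΨJ u)) =
        w u * Complex.exp (q u * (τ * s ^ 2 / 2 : ℝ)) := by
    simp only [hw]
    rw [mul_assoc (Complex.exp (z u * x)), ← Complex.exp_add (τ * ΨJ u)]
    congr 2
    push_cast
    ring
  have hpos {s : ℝ} (hs : 0 < s) : 0 < τ * s ^ 2 / 2 := by positivity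
  have hinner (s : ℝ) : HasDerivAt (fun s : ℝ => τ * s ^ 2 / 2) (τ * s) s := by
    refine (((hasDerivAt_pow 2 s).const_mul τ).div_const 2).congr_deriv ?_
    push_cast
    ring
  have hV {s : ℝ} (hs : 0 < s) : HasDerivAt
      (fun s : ℝ => c * ∫ u : ℝ,
        Complex.exp (z u * x) * Complex.exp (τ * (q u * (s : ℂ) ^ 2 / 2 + ΨJ u)) / q u)
      (c * ((τ * s : ℝ) • ∫ u, w u * Complex.exp (q u * (τ * s ^ 2 / 2 : ℝ)))) s := by
    have h := ((hasDerivAt_integral_mul_cexp hgm.aestronglyMeasurable hqm hgC hqle hqre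
      (hpos hs)).2.2.scomp s (hinner s)).const_mul c
    simp only [div_mul_cancel₀ _ (hq0 _)] at h
    refine h.congr_of_eventuallyEq (Filter.Eventually.of_forall fun t => ?_)
    simp only [hexp, Function.comp, mul_div_right_comm (w _)]
  intro σ hσ
  have hσ0 : 0 < σ := hSig₁.trans hσ.1
  refine ⟨(hV hσ0).differentiableAt, ?_⟩
  obtain ⟨hi₁, hi₂, hd⟩ := hasDerivAt_integral_mul_cexp hwm.aestronglyMeasurable hqm hwC hqle hqre
    (hpos hσ0)
  have h := ((((hasDerivAt_id σ).const_mul τ).smul (hd.scomp σ (hinner σ))).const_mul c)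
  refine (h.congr_of_eventuallyEq ?_).congr_deriv ?_
  · filter_upwards [lt_mem_nhds hσ0] with s hs
    exact (hV hs).deriv
  · have hsplit (u : ℝ) : Complex.exp (z u * x) *
          Complex.exp (τ * (q u * (σ : ℂ) ^ 2 / 2 + ΨJ u)) *
          (1 + (τ : ℂ) * (σ : ℂ) ^ 2 * Complex.I * ((u : ℂ) + (v : ℂ) * Complex.I) * (1 + z u)) =
        w u * Complex.exp (q u * (τ * σ ^ 2 / 2 : ℝ)) +
          (τ * σ ^ 2 : ℂ) * (w u * q u * Complex.exp (q u * (τ * σ ^ 2 / 2 : ℝ))) := by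
      rw [hexp]
      simp only [hqdef, hz]
      ring
    refine Eq.trans ?_ (congrArg _ (integral_congr_ae (ae_of_all _ hsplit))).symm
    rw [integral_add hi₁ (hi₂.const_mul _), integral_const_mul]
    simp only [Complex.real_smul, id, mul_one, Function.comp, Complex.ofReal_mul]
    ring
end

section
/- Assume ∫_ℝ |u+iv|·|φ(u+iv)| du < ∞, so that μ has a continuously differentiable density f given by f(x) = (1/2π)∫_ℝ e^{i(u+iv)x} φ(u+iv) du. Fix K > 0, r ≥ 0, and for S > 0 set x(S) := ln(K/S) − rτ and C(S) := S·∫_ℝ (e^{s} − e^{x(S)})⁺ μ(ds). Then C is three times differentiable on (0,∞) and the Speed satisfies C'''(S) = −(e^{x(S)}/S²)·( 2·f(x(S)) + f'(x(S)) ). -/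
open MeasureTheory
open scoped FourierTransform SchwartzMap ContDiff Topology

/-- The Parseval identity between a finite measure and a Schwartz function. -/
theorem SchwartzMap.integral_measure_eq_integral_mul_fourierInv_charFun
    {ν : Measure ℝ} [IsFiniteMeasure ν]
    (hν : Integrable fun x : ℝ => charFun ν (-(2 * Real.pi * x))) (h : 𝓢(ℝ, ℂ)) :
    ∫ s, h s ∂ν = ∫ x, h x * 𝓕⁻ (fun x : ℝ => charFun ν (-(2 * Real.pi * x))) x := by
  have hchar : ∀ x : ℝ, VectorFourier.fourierIntegral Real.fourierChar ν (innerₗ ℝ).flip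
      (1 : ℝ → ℂ) x = charFun ν (-(2 * Real.pi * x)) := by
    intro x
    rw [charFun_eq_fourierIntegral', flip_innerₗ]
    congr 1
    simp only [smul_eq_mul]
    field_simp
  have h₁ := VectorFourier.integral_fourierIntegral_smul_eq_flip (μ := volume) (ν := ν)
    (L := innerₗ ℝ) (f := (𝓕⁻ h : 𝓢(ℝ, ℂ))) (g := (1 : ℝ → ℂ)) Real.continuous_fourierChar
    continuous_inner (𝓕⁻ h : 𝓢(ℝ, ℂ)).integrable (integrable_const _)
  have h₂ := VectorFourier.integral_fourierIntegral_smul_eq_flip (μ := volume) (ν := volume)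
    (L := -innerₗ ℝ) (f := (h : ℝ → ℂ)) Real.continuous_fourierChar
    continuous_inner.neg h.integrable hν
  have hfl : (-innerₗ ℝ).flip = -innerₗ ℝ := by
    ext
    simp
  simp only [hchar, smul_eq_mul, Pi.one_apply, mul_one, hfl] at h₁ h₂
  have hinv : (fun ξ => VectorFourier.fourierIntegral Real.fourierChar volume (innerₗ ℝ)
      (𝓕⁻ h : 𝓢(ℝ, ℂ)) ξ) = h := by
    have hF : 𝓕 (𝓕⁻ h : 𝓢(ℝ, ℂ)) = h := FourierTransform.fourier_fourierInv_eq h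
    exact congrArg (fun k : 𝓢(ℝ, ℂ) => (k : ℝ → ℂ)) hF
  calc ∫ s, h s ∂ν = ∫ x, (𝓕⁻ h : 𝓢(ℝ, ℂ)) x * charFun ν (-(2 * Real.pi * x)) := by
        rw [← h₁, hinv]
    _ = _ := by
        rw [SchwartzMap.fourierInv_coe]
        exact h₂

/-- A finite measure and a continuous density with the same integrals against smooth compactly
supported functions give the same mass to bounded open intervals. -/
theorem measureReal_Ioo_eq_setIntegral {ν : Measure ℝ} [IsFiniteMeasure ν] {g : ℝ → ℝ}
    (hg : Continuous g)
    (h : ∀ k : ℝ → ℝ, ContDiff ℝ ∞ k → HasCompactSupport k → ∫ s, k s ∂ν = ∫ x, k x * g x)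
    (a b : ℝ) : ν.real (Set.Ioo a b) = ∫ x in Set.Ioo a b, g x := by
  obtain ⟨p, hsupp, hsmooth, hrange⟩ :=
    (isOpen_Ioo (a := a) (b := b)).exists_contDiff_support_eq (n := ⊤)
  have hp : ∀ x, 0 ≤ p x ∧ p x ≤ 1 := fun x => hrange ⟨x, rfl⟩
  have hp_zero : ∀ x, x ∉ Set.Ioo a b → p x = 0 := fun x hx => by
    rwa [← hsupp, Function.notMem_support] at hx
  have hp_pos : ∀ x, x ∈ Set.Ioo a b → 0 < p x := fun x hx =>
    lt_of_le_of_ne (hp x).1 (Ne.symm (by rwa [← hsupp, Function.mem_support] at hx))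
  let q : ℕ → ℝ → ℝ := fun n x => 1 - (1 - p x) ^ n
  have hq_smooth : ∀ n, ContDiff ℝ ∞ (q n) := fun n =>
    contDiff_const.sub ((contDiff_const.sub hsmooth).pow n)
  have hq_zero : ∀ n x, x ∉ Set.Ioo a b → q n x = 0 := fun n x hx => by
    simp [q, hp_zero x hx]
  have hq_supp : ∀ n, HasCompactSupport (q n) := fun n =>
    HasCompactSupport.intro isCompact_Icc (K := Set.Icc a b) fun x hx =>
      hq_zero n x fun hx' => hx (Set.Ioo_subset_Icc_self hx')
  have hq_bound : ∀ n x, ‖q n x‖ ≤ 1 := fun n x => by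
    have h0 : 0 ≤ (1 - p x) ^ n := pow_nonneg (by linarith [hp x]) n
    have h1 : (1 - p x) ^ n ≤ 1 := pow_le_one₀ (by linarith [hp x]) (by linarith [hp x])
    rw [Real.norm_eq_abs, abs_le]
    constructor <;> simp only [q] <;> linarith
  have hq_lim : ∀ x, Filter.Tendsto (fun n => q n x) Filter.atTop
      (𝓝 ((Set.Ioo a b).indicator 1 x)) := fun x => by
    by_cases hx : x ∈ Set.Ioo a b
    · rw [Set.indicator_of_mem hx]
      have := tendsto_pow_atTop_nhds_zero_of_lt_one (r := 1 - p x) (by linarith [hp x])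
        (by linarith [hp_pos x hx])
      simpa [q] using this.const_sub 1
    · simp [Set.indicator_of_notMem hx, hq_zero _ x hx]
  have hlim₁ : Filter.Tendsto (fun n => ∫ s, q n s ∂ν) Filter.atTop
      (𝓝 (∫ s, (Set.Ioo a b).indicator 1 s ∂ν)) :=
    tendsto_integral_of_dominated_convergence (fun _ => 1)
      (fun n => (hq_smooth n).continuous.aestronglyMeasurable) (integrable_const _)
      (fun n => ae_of_all _ (hq_bound n)) (ae_of_all _ hq_lim)
  have hlim₂ : Filter.Tendsto (fun n => ∫ x, q n x * g x) Filter.atTop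
      (𝓝 (∫ x, (Set.Ioo a b).indicator 1 x * g x)) := by
    refine tendsto_integral_of_dominated_convergence
      ((Set.Ioo a b).indicator fun x => ‖g x‖)
      (fun n => ((hq_smooth n).continuous.mul hg).aestronglyMeasurable) ?_
      (fun n => ae_of_all _ fun x => ?_) (ae_of_all _ fun x => (hq_lim x).mul_const _)
    · exact (integrable_indicator_iff measurableSet_Ioo).2
        ((hg.norm.integrableOn_Icc (a := a) (b := b)).mono_set Set.Ioo_subset_Icc_self)
    · by_cases hx : x ∈ Set.Ioo a b
      · rw [Set.indicator_of_mem hx, norm_mul]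
        exact mul_le_of_le_one_left (norm_nonneg _) (hq_bound n x)
      · simp [hq_zero n x hx, Set.indicator_of_notMem hx]
  have hlim := tendsto_nhds_unique hlim₁
    (by simpa only [h _ (hq_smooth _) (hq_supp _)] using hlim₂)
  rw [integral_indicator_one measurableSet_Ioo] at hlim
  rw [hlim, ← integral_indicator measurableSet_Ioo]
  congr 1
  ext x
  by_cases hx : x ∈ Set.Ioo a b <;> simp [hx]

/-- A continuous function whose integrals over bounded open intervals are nonnegative is
nonnegative. -/
theorem Continuous.nonneg_of_setIntegral_Ioo_nonneg {g : ℝ → ℝ} (hg : Continuous g)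
    (h : ∀ a b, 0 ≤ ∫ x in Set.Ioo a b, g x) (x : ℝ) : 0 ≤ g x := by
  by_contra! hx
  obtain ⟨ε, hε, hball⟩ := Metric.mem_nhds_iff.1
    ((isOpen_Iio.preimage hg).mem_nhds (show x ∈ g ⁻¹' Set.Iio (g x / 2) by
      simp only [Set.mem_preimage, Set.mem_Iio]; linarith))
  rw [Real.ball_eq_Ioo] at hball
  have hle : ∫ y in Set.Ioo (x - ε) (x + ε), g y ≤ ∫ y in Set.Ioo (x - ε) (x + ε), g x / 2 :=
    setIntegral_mono_on ((hg.integrableOn_Icc).mono_set Set.Ioo_subset_Icc_self)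
      (integrableOn_const (by simp)) measurableSet_Ioo fun y hy => (hball hy).le
  rw [setIntegral_const, Real.volume_real_Ioo_of_le (by linarith), smul_eq_mul] at hle
  nlinarith [h (x - ε) (x + ε)]

/-- A finite measure on `ℝ` with integrable characteristic function has a continuous density,
given by the inversion formula. -/
theorem eq_withDensity_of_integrable_charFun {ν : Measure ℝ} [IsFiniteMeasure ν]
    (hν : Integrable fun x : ℝ => charFun ν (-(2 * Real.pi * x))) {g : ℝ → ℝ}
    (hg : Continuous g)
    (hgν : ∀ x, (g x : ℂ) = 𝓕⁻ (fun x : ℝ => charFun ν (-(2 * Real.pi * x))) x) :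
    (∀ x, 0 ≤ g x) ∧ ν = volume.withDensity fun x => ENNReal.ofReal (g x) := by
  have htest : ∀ k : ℝ → ℝ, ContDiff ℝ ∞ k → HasCompactSupport k →
      ∫ s, k s ∂ν = ∫ x, k x * g x := by
    intro k hk hk'
    have hsmooth : ContDiff ℝ ∞ fun x => (k x : ℂ) := Complex.ofRealCLM.contDiff.comp hk
    have hsupp : HasCompactSupport fun x => (k x : ℂ) := hk'.comp_left Complex.ofReal_zero
    have hpair : ∫ s, (k s : ℂ) ∂ν = ∫ x, (k x : ℂ) * g x := by
      simp only [hgν]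
      exact SchwartzMap.integral_measure_eq_integral_mul_fourierInv_charFun hν
        (hsupp.toSchwartzMap hsmooth)
    simp only [← Complex.ofReal_mul] at hpair
    rw [integral_complex_ofReal, integral_complex_ofReal] at hpair
    exact_mod_cast hpair
  have hIoo := measureReal_Ioo_eq_setIntegral hg htest
  have hnonneg := hg.nonneg_of_setIntegral_Ioo_nonneg fun a b => hIoo a b ▸ measureReal_nonneg
  refine ⟨hnonneg, Real.measure_ext_Ioo_rat fun a b => ?_⟩
  rw [withDensity_apply _ measurableSet_Ioo,
    ← ofReal_integral_eq_lintegral_ofReal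
      ((hg.integrableOn_Icc).mono_set Set.Ioo_subset_Icc_self) (ae_of_all _ hnonneg), ← hIoo,
    ofReal_measureReal]

/-- Derivative of the tail integral of a continuous function against a continuous density. -/
theorem hasDerivAt_setIntegral_Ioi_withDensity {f F : ℝ → ℝ} (hf : Continuous f)
    (hf0 : ∀ x, 0 ≤ f x) (hF : Continuous F)
    (hint : Integrable F (volume.withDensity fun x => ENNReal.ofReal (f x))) (x : ℝ) :
    HasDerivAt
      (fun y => ∫ s in Set.Ioi y, F s ∂(volume.withDensity fun x => ENNReal.ofReal (f x)))
      (-(F x * f x)) x := by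
  have hmeas : Measurable fun x => ENNReal.ofReal (f x) := hf.measurable.ennreal_ofReal
  have hint' : Integrable fun s => f s * F s := by
    have := (integrable_withDensity_iff_integrable_smul' hmeas
      (ae_of_all _ fun _ => ENNReal.ofReal_lt_top)).1 hint
    simpa only [ENNReal.toReal_ofReal (hf0 _), smul_eq_mul] using this
  have hcont : Continuous fun s => f s * F s := hf.mul hF
  have htail : (fun y => ∫ s in Set.Ioi y, F s ∂(volume.withDensity fun x => ENNReal.ofReal (f x)))
      = fun y => (∫ s in Set.Ioi 0, f s * F s) - ∫ s in 0..y, f s * F s := by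
    ext y
    rw [setIntegral_withDensity_eq_setIntegral_toReal_smul hmeas
      (ae_of_all _ fun _ => ENNReal.ofReal_lt_top) _ measurableSet_Ioi,
      ← intervalIntegral.integral_Ioi_sub_Ioi' hint'.integrableOn hint'.integrableOn]
    simp only [ENNReal.toReal_ofReal (hf0 _), smul_eq_mul, sub_sub_cancel]
  rw [htail, mul_comm]
  exact (intervalIntegral.integral_hasDerivAt_right (hcont.intervalIntegrable _ _)
    (hcont.stronglyMeasurableAtFilter _ _) hcont.continuousAt).const_sub _

theorem integral_max_exp_sub_exp {μ : Measure ℝ} [IsFiniteMeasure μ]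
    (hexp : Integrable (fun s : ℝ => Real.exp s) μ) (x : ℝ) :
    ∫ s, max (Real.exp s - Real.exp x) 0 ∂μ =
      (∫ s in Set.Ioi x, Real.exp s ∂μ) - Real.exp x * ∫ _ in Set.Ioi x, (1 : ℝ) ∂μ := by
  rw [← integral_const_mul, ← integral_sub hexp.integrableOn (integrable_const _),
    ← integral_indicator measurableSet_Ioi]
  congr 1
  ext s
  by_cases hs : x < s
  · rw [Set.indicator_of_mem (Set.mem_Ioi.2 hs), max_eq_left, mul_one]
    exact sub_nonneg.2 (Real.exp_le_exp.2 hs.le)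
  · rw [Set.indicator_of_notMem (by simpa using hs), max_eq_right]
    exact sub_nonpos.2 (Real.exp_le_exp.2 (not_lt.1 hs))

theorem hasDerivAt_log_div_sub_const {K S : ℝ} (hK : 0 < K) (hS : 0 < S) (c : ℝ) :
    HasDerivAt (fun S => Real.log (K / S) - c) (-(1 / S)) S := by
  have h := (((hasDerivAt_id S).fun_inv hS.ne').const_mul K).log
    (mul_pos hK (inv_pos.2 hS)).ne'
  simp only [id, ← div_eq_mul_inv] at h
  refine (h.sub_const c).congr_deriv ?_
  field_simp

section CallPrice

variable {μ : Measure ℝ} [IsFiniteMeasure μ] {f : ℝ → ℝ}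

/-- The Delta of a call option. -/
theorem hasDerivAt_callPrice (hexp : Integrable (fun s : ℝ => Real.exp s) μ)
    (hf : Continuous f) (hf0 : ∀ x, 0 ≤ f x)
    (hμ : μ = volume.withDensity fun x => ENNReal.ofReal (f x))
    {K S : ℝ} (hK : 0 < K) (hS : 0 < S) (c : ℝ) :
    HasDerivAt
      (fun S : ℝ => S * ∫ s : ℝ, max (Real.exp s - Real.exp (Real.log (K / S) - c)) 0 ∂μ)
      (∫ s in Set.Ioi (Real.log (K / S) - c), Real.exp s ∂μ) S := by
  have hP : ∀ x, HasDerivAt (fun y => ∫ s in Set.Ioi y, Real.exp s ∂μ) (-(Real.exp x * f x)) x := by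
    subst hμ
    exact hasDerivAt_setIntegral_Ioi_withDensity hf hf0 Real.continuous_exp hexp
  have hQ : ∀ x, HasDerivAt (fun y => ∫ _ in Set.Ioi y, (1 : ℝ) ∂μ) (-(1 * f x)) x := by
    subst hμ
    exact hasDerivAt_setIntegral_Ioi_withDensity hf hf0 continuous_const (integrable_const _)
  simp only [integral_max_exp_sub_exp hexp]
  have hx := hasDerivAt_log_div_sub_const hK hS c
  set x := Real.log (K / S) - c with hxS
  refine ((hasDerivAt_id S).mul
    ((((hP x).sub ((Real.hasDerivAt_exp x).mul (hQ x)))).comp S hx)).congr_deriv ?_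
  simp only [Function.comp_apply, Pi.sub_apply, Pi.mul_apply, id, ← hxS]
  field_simp
  ring

/-- The Gamma of a call option. -/
theorem hasDerivAt_callDelta (hexp : Integrable (fun s : ℝ => Real.exp s) μ)
    (hf : Continuous f) (hf0 : ∀ x, 0 ≤ f x)
    (hμ : μ = volume.withDensity fun x => ENNReal.ofReal (f x))
    {K S : ℝ} (hK : 0 < K) (hS : 0 < S) (c : ℝ) :
    HasDerivAt (fun S : ℝ => ∫ s in Set.Ioi (Real.log (K / S) - c), Real.exp s ∂μ)
      (Real.exp (Real.log (K / S) - c) * f (Real.log (K / S) - c) / S) S := by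
  subst hμ
  refine ((hasDerivAt_setIntegral_Ioi_withDensity hf hf0 Real.continuous_exp hexp _).comp S
    (hasDerivAt_log_div_sub_const hK hS c)).congr_deriv ?_
  ring

/-- Derivative of the Gamma of a call option. -/
theorem hasDerivAt_callGamma (hf : Differentiable ℝ f) {K S : ℝ} (hK : 0 < K) (hS : 0 < S)
    (c : ℝ) :
    HasDerivAt
      (fun S : ℝ => Real.exp (Real.log (K / S) - c) * f (Real.log (K / S) - c) / S)
      (-(Real.exp (Real.log (K / S) - c) / S ^ 2) *
        (2 * f (Real.log (K / S) - c) + deriv f (Real.log (K / S) - c))) S := by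
  have hx := hasDerivAt_log_div_sub_const hK hS c
  set x := Real.log (K / S) - c with hxS
  refine ((((Real.hasDerivAt_exp x).mul (hf x).hasDerivAt).comp S hx).div
    (hasDerivAt_id S) hS.ne').congr_deriv ?_
  simp only [Function.comp_apply, Pi.mul_apply, id, ← hxS]
  field_simp
  ring

end CallPrice

/-- Exponential tilting turns the generalized characteristic function into a characteristic
function. -/
theorem charFun_withDensity_exp {μ : Measure ℝ} (v u : ℝ) :
    charFun (μ.withDensity fun s => ENNReal.ofReal (Real.exp (v * s))) (-u) =
      ∫ s : ℝ, Complex.exp (-(Complex.I * ((u : ℂ) + (v : ℂ) * Complex.I) * (s : ℂ))) ∂μ := by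
  rw [charFun_apply_real, integral_withDensity_eq_integral_toReal_smul (by fun_prop)
    (ae_of_all _ fun _ => ENNReal.ofReal_lt_top)]
  congr 1
  ext s
  rw [ENNReal.toReal_ofReal (Real.exp_nonneg _), Complex.real_smul, Complex.ofReal_exp,
    ← Complex.exp_add]
  congr 1
  push_cast
  linear_combination ((v : ℂ) * s) * Complex.I_sq

theorem fourierInv_comp_two_pi_mul (H : ℝ → ℂ) (x : ℝ) :
    𝓕⁻ (fun y : ℝ => H (2 * Real.pi * y)) x =
      1 / (2 * (Real.pi : ℂ)) * ∫ u : ℝ, Complex.exp (Complex.I * u * x) * H u := by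
  have h := Measure.integral_comp_mul_left
    (fun u : ℝ => Complex.exp (Complex.I * u * x) * H u) (2 * Real.pi)
  rw [abs_of_pos (inv_pos.2 Real.two_pi_pos), Complex.real_smul] at h
  rw [Real.fourierInv_eq']
  convert h using 1
  · congr 1
    ext y
    rw [smul_eq_mul]
    congr 2
    simp
    ring
  · push_cast
    rw [one_div]

theorem exp_mul_integral_fourier_shift (v x : ℝ) (H : ℝ → ℂ) :
    Complex.exp (v * x) * ∫ u : ℝ,
        Complex.exp (Complex.I * ((u : ℂ) + (v : ℂ) * Complex.I) * (x : ℂ)) * H u =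
      ∫ u : ℝ, Complex.exp (Complex.I * u * x) * H u := by
  rw [← integral_const_mul]
  congr 1
  ext u
  rw [← mul_assoc, ← Complex.exp_add]
  congr 2
  linear_combination (v * x : ℂ) * Complex.I_sq

/-- Speed of a call option: if `∫ |u+iv|·|φ(u+iv)| du < ∞` then `μ` has a continuously
differentiable density `f` given by `f(x) = (1/2π)∫ e^{i(u+iv)x} φ(u+iv) du`, and with
`x(S) = ln(K/S) - rτ` and `C(S) = S·∫(e^s - e^{x(S)})⁺ μ(ds)`, the price `C` is three
times differentiable on `(0,∞)` with `C'''(S) = -(e^{x(S)}/S²)(2 f(x(S)) + f'(x(S)))`. -/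
theorem call_Speed
    (v τ : ℝ) (hv : 1 < v) (hτ : 0 < τ)
    (μ : Measure ℝ) [IsProbabilityMeasure μ]
    (hμv : Integrable (fun s : ℝ => Real.exp (v * s)) μ)
    (hmart1 : Integrable (fun s : ℝ => Real.exp s) μ)
    (hmart2 : ∫ s : ℝ, Real.exp s ∂μ = 1)
    (φ : ℂ → ℂ)
    (hφ : ∀ z : ℂ, φ z = ∫ s : ℝ, Complex.exp (-(Complex.I * z * (s : ℂ))) ∂μ)
    (hint : Integrable (fun u : ℝ =>
      ‖(u : ℂ) + (v : ℂ) * Complex.I‖ * ‖φ ((u : ℂ) + (v : ℂ) * Complex.I)‖))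
    (f : ℝ → ℝ)
    (hf : ∀ x : ℝ, ((f x : ℝ) : ℂ) =
      (1 / (2 * (Real.pi : ℂ))) *
        ∫ u : ℝ,
          Complex.exp (Complex.I * ((u : ℂ) + (v : ℂ) * Complex.I) * (x : ℂ)) *
            φ ((u : ℂ) + (v : ℂ) * Complex.I))
    (K r : ℝ) (hK : 0 < K) (hr : 0 ≤ r) :
    ContDiff ℝ 1 f ∧
    μ = volume.withDensity (fun x => ENNReal.ofReal (f x)) ∧
    ∀ S ∈ Set.Ioi (0 : ℝ),
      DifferentiableAt ℝ
        (fun S : ℝ => S * ∫ s : ℝ, max (Real.exp s - Real.exp (Real.log (K / S) - r * τ)) 0 ∂μ)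
        S ∧
      DifferentiableAt ℝ
        (deriv fun S : ℝ =>
          S * ∫ s : ℝ, max (Real.exp s - Real.exp (Real.log (K / S) - r * τ)) 0 ∂μ) S ∧
      HasDerivAt
        (deriv (deriv fun S : ℝ =>
          S * ∫ s : ℝ, max (Real.exp s - Real.exp (Real.log (K / S) - r * τ)) 0 ∂μ))
        (-(Real.exp (Real.log (K / S) - r * τ) / S ^ 2) *
          (2 * f (Real.log (K / S) - r * τ) + deriv f (Real.log (K / S) - r * τ))) S := by
  set H : ℝ → ℂ := fun u => φ ((u : ℂ) + (v : ℂ) * Complex.I)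
  set ν : Measure ℝ := μ.withDensity fun s => ENNReal.ofReal (Real.exp (v * s)) with hν
  have : IsFiniteMeasure ν := isFiniteMeasure_withDensity_ofReal hμv.2
  have hHν : ∀ u, H u = charFun ν (-u) := fun u => by
    rw [hν, charFun_withDensity_exp]
    exact hφ _
  have hH_cont : Continuous H := by
    rw [funext hHν]
    exact continuous_charFun.comp continuous_neg
  have hz_im : ∀ u : ℝ, 1 ≤ ‖(u : ℂ) + (v : ℂ) * Complex.I‖ := fun u => by
    have := Complex.abs_im_le_norm ((u : ℂ) + (v : ℂ) * Complex.I)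
    simp only [Complex.add_im, Complex.ofReal_im, Complex.mul_im, Complex.ofReal_re, Complex.I_im,
      Complex.I_re, mul_one, mul_zero, add_zero, zero_add] at this
    exact hv.le.trans ((le_abs_self v).trans this)
  have hz_re : ∀ u : ℝ, ‖u‖ ≤ ‖(u : ℂ) + (v : ℂ) * Complex.I‖ := fun u => by
    simpa using Complex.abs_re_le_norm ((u : ℂ) + (v : ℂ) * Complex.I)
  have hH_int : Integrable H := hint.mono' hH_cont.aestronglyMeasurable <| ae_of_all _ fun u =>
    le_mul_of_one_le_left (norm_nonneg _) (hz_im u)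
  have hH_int' : Integrable fun u => u * ‖H u‖ :=
    hint.mono' (continuous_id.mul hH_cont.norm).aestronglyMeasurable <| ae_of_all _ fun u => by
      rw [norm_mul, norm_norm]
      exact mul_le_mul_of_nonneg_right (hz_re u) (norm_nonneg _)
  have hN : Integrable fun x : ℝ => charFun ν (-(2 * Real.pi * x)) := by
    simpa only [hHν] using hH_int.comp_mul_left' Real.two_pi_pos.ne'
  have hN' : Integrable fun x : ℝ => ‖x‖ * ‖charFun ν (-(2 * Real.pi * x))‖ := by
    have h := ((hH_int'.comp_mul_left' Real.two_pi_pos.ne').const_mul (2 * Real.pi)⁻¹).norm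
    refine h.congr (ae_of_all _ fun x => ?_)
    simp only [hHν, norm_mul, norm_norm, norm_inv]
    field_simp
  have hgν : ∀ x, ((Real.exp (v * x) * f x : ℝ) : ℂ) =
      𝓕⁻ (fun x : ℝ => charFun ν (-(2 * Real.pi * x))) x := fun x => by
    simp only [← hHν]
    rw [fourierInv_comp_two_pi_mul, ← exp_mul_integral_fourier_shift v]
    push_cast
    rw [hf]
    ring
  have hN_smooth : ContDiff ℝ 1 (𝓕⁻ fun x : ℝ => charFun ν (-(2 * Real.pi * x))) := by
    have h : ContDiff ℝ ((1 : ℕ∞) : WithTop ℕ∞) (𝓕 fun x : ℝ => charFun ν (-(2 * Real.pi * x))) :=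
      Real.contDiff_fourier fun n hn => by
        have hn' : n ≤ 1 := by exact_mod_cast hn
        interval_cases n
        · simpa using hN.norm
        · simpa using hN'
    rw [funext (Real.fourierInv_eq_fourier_neg _)]
    exact h.comp contDiff_neg
  have hg_smooth : ContDiff ℝ 1 fun x => Real.exp (v * x) * f x := by
    convert! Complex.reCLM.contDiff.comp hN_smooth using 1
    ext x
    rw [Function.comp_apply, ← hgν, Complex.reCLM_apply, Complex.ofReal_re]
  have hfg : ∀ x, f x = Real.exp (-(v * x)) * (Real.exp (v * x) * f x) := fun x => by
    rw [← mul_assoc, ← Real.exp_add, neg_add_cancel, Real.exp_zero, one_mul]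
  have hf_smooth : ContDiff ℝ 1 f := by
    rw [funext hfg]
    exact (Real.contDiff_exp.comp (contDiff_const.mul contDiff_id).neg).mul hg_smooth
  obtain ⟨hg0, hνg⟩ := eq_withDensity_of_integrable_charFun hN hg_smooth.continuous hgν
  have hf0 : ∀ x, 0 ≤ f x := fun x => nonneg_of_mul_nonneg_right (hg0 x) (Real.exp_pos _)
  have hμf : μ = volume.withDensity fun x => ENNReal.ofReal (f x) := by
    calc μ = ν.withDensity fun s => ENNReal.ofReal (Real.exp (-(v * s))) := by
          rw [hν, ← withDensity_mul _ (by fun_prop) (by fun_prop)]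
          simp [Pi.mul_def, ← ENNReal.ofReal_mul (Real.exp_nonneg _), ← Real.exp_add]
      _ = _ := by
          rw [hνg, ← withDensity_mul _ hg_smooth.continuous.measurable.ennreal_ofReal
            (by fun_prop)]
          congr 1
          ext x
          rw [Pi.mul_apply, ← ENNReal.ofReal_mul (hg0 x), mul_comm, ← hfg]
  have hΔ := fun (S : ℝ) (hS : 0 < S) =>
    hasDerivAt_callPrice hmart1 hf_smooth.continuous hf0 hμf hK hS (r * τ)
  have hΓ := fun (S : ℝ) (hS : 0 < S) =>
    hasDerivAt_callDelta hmart1 hf_smooth.continuous hf0 hμf hK hS (r * τ)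
  have hderiv : ∀ S : ℝ, 0 < S → HasDerivAt
      (deriv fun S : ℝ =>
        S * ∫ s : ℝ, max (Real.exp s - Real.exp (Real.log (K / S) - r * τ)) 0 ∂μ)
      (Real.exp (Real.log (K / S) - r * τ) * f (Real.log (K / S) - r * τ) / S) S := fun S hS =>
    (hΓ S hS).congr_of_eventuallyEq <| by
      filter_upwards [lt_mem_nhds hS] with T hT using (hΔ T hT).deriv
  refine ⟨hf_smooth, hμf, fun S hS => ⟨(hΔ S hS).differentiableAt,
    (hderiv S hS).differentiableAt, ?_⟩⟩
  refine (hasDerivAt_callGamma (hf_smooth.differentiable one_ne_zero) hK hS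
    (r * τ)).congr_of_eventuallyEq ?_
  filter_upwards [lt_mem_nhds (Set.mem_Ioi.1 hS)] with T hT using (hderiv T hT).deriv
end
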